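/- arXiv:1512.00620 — 4 statements merged into one kernel-verified Lean document; each statement's English description precedes it below -/
import Mathlib

section
/- There exists a continuous function f : [0,∞) → [0,∞)^d such that for every w ≥ 0: (i) θ·f(w) = w; (ii) C(f(w)) = inf{ C(q) : q ∈ [0,∞)^d, θ·q = w }; and (iii) µ₁C₁′(f₁(w)) = µ₂C₂′(f₂(w)) = ⋯ = µ_d C_d′(f_d(w)). -/
/-- A cost function `C` with derivative `C'`, as in the generalized cμ rule setting:
`C : [0,∞) → [0,∞)` is strictly increasing, strictly convex, continuously
differentiable, with `C(0) = C'(0) = 0`. -/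
structure CostFun where
  C : ℝ → ℝ
  C' : ℝ → ℝ
  nonneg : ∀ x ≥ (0:ℝ), 0 ≤ C x
  strictMono : StrictMonoOn C (Set.Ici (0:ℝ))
  strictConvex : StrictConvexOn ℝ (Set.Ici (0:ℝ)) C
  hasDeriv : ∀ x ≥ (0:ℝ), HasDerivWithinAt C (C' x) (Set.Ici (0:ℝ)) x
  contDeriv : ContinuousOn C' (Set.Ici (0:ℝ))
  zero : C 0 = 0
  deriv_zero : C' 0 = 0

namespace CostFun

lemma strictMonoOn_deriv (c : CostFun) : StrictMonoOn c.C' (Set.Ici 0) := fun x hx y hy hxy =>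
  (c.strictConvex.lt_slope_of_hasDerivWithinAt hx hy hxy (c.hasDeriv x hx)).trans
    (c.strictConvex.slope_lt_of_hasDerivWithinAt hx hy hxy (c.hasDeriv y hy))

lemma deriv_nonneg (c : CostFun) {x : ℝ} (hx : 0 ≤ x) : 0 ≤ c.C' x :=
  c.deriv_zero ▸ c.strictMonoOn_deriv.monotoneOn Set.self_mem_Ici hx hx

lemma continuousOn (c : CostFun) : ContinuousOn c.C (Set.Ici 0) := fun x hx =>
  (c.hasDeriv x hx).continuousWithinAt

end CostFun

/-- The allocations `q ≥ 0` with weighted total `∑ i, q i / μ i` equal to `w`. -/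
def workloadSimplex {d : ℕ} (μ : Fin d → ℝ) (w : ℝ) : Set (Fin d → ℝ) :=
  {q | (∀ i, 0 ≤ q i) ∧ ∑ i, (μ i)⁻¹ * q i = w}

section

variable {d : ℕ} {μ : Fin d → ℝ}

lemma isCompact_workloadSimplex (hμ : ∀ i, 0 < μ i) (w : ℝ) :
    IsCompact (workloadSimplex μ w) := by
  have hcl : IsClosed (workloadSimplex μ w) := by
    have h0 : IsClosed {q : Fin d → ℝ | ∀ i, 0 ≤ q i} := by
      simp only [Set.ofPred_forall]
      exact isClosed_iInter fun i => isClosed_le continuous_const (continuous_apply i)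
    exact h0.inter (isClosed_eq (by fun_prop) continuous_const)
  refine (isCompact_Icc (a := (0 : Fin d → ℝ)) (b := fun i => μ i * w)).of_isClosed_subset hcl ?_
  rintro q ⟨hq, hw⟩
  refine ⟨hq, fun i => ?_⟩
  have hi : (μ i)⁻¹ * q i ≤ w := hw ▸
    Finset.single_le_sum (f := fun i => (μ i)⁻¹ * q i)
      (fun j _ => mul_nonneg (inv_nonneg.2 (hμ j).le) (hq j)) (Finset.mem_univ i)
  rwa [inv_mul_le_iff₀ (hμ i)] at hi

lemma workloadSimplex_nonempty (hd : 0 < d) (hμ : ∀ i, 0 < μ i) {w : ℝ} (hw : 0 ≤ w) :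
    (workloadSimplex μ w).Nonempty := by
  refine ⟨Pi.single ⟨0, hd⟩ (μ ⟨0, hd⟩ * w), fun i => ?_, ?_⟩
  · have h : (0 : Fin d → ℝ) ≤ Pi.single ⟨0, hd⟩ (μ ⟨0, hd⟩ * w) :=
      Pi.single_nonneg.2 (mul_nonneg (hμ _).le hw)
    exact h i
  · rw [Finset.sum_eq_single ⟨0, hd⟩]
    · simp [(hμ _).ne']
    · intro b _ hb
      simp [hb]
    · simp

/-- Shifting load from `j` to `i` cannot lower the cost at a minimizer, which gives the
first-order condition. -/
lemma mul_deriv_le_of_isMinOn (hμ : ∀ i, 0 < μ i) (cf : Fin d → CostFun) {w : ℝ}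
    {q : Fin d → ℝ} (hq : q ∈ workloadSimplex μ w)
    (hmin : IsMinOn (fun q => ∑ i, (cf i).C (q i)) (workloadSimplex μ w) q) (i j : Fin d) :
    μ j * (cf j).C' (q j) ≤ μ i * (cf i).C' (q i) := by
  obtain ⟨hq0, hqw⟩ := hq
  rcases (hq0 j).eq_or_lt with hj | hj
  · rw [← hj, (cf j).deriv_zero, mul_zero]
    exact mul_nonneg (hμ i).le ((cf i).deriv_nonneg (hq0 i))
  set v : Fin d → ℝ := fun k => (Pi.single i (μ i) : Fin d → ℝ) k - (Pi.single j (μ j) : Fin d → ℝ) k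
    with hv
  have hsum (a : Fin d → ℝ) : ∑ k, a k * v k = a i * μ i - a j * μ j := by
    simp [hv, mul_sub, Finset.sum_sub_distrib, Pi.single_apply]
  set ε := q j / μ j with hε
  have hε0 : 0 < ε := div_pos hj (hμ j)
  have hnonneg : ∀ t ∈ Set.Icc 0 ε, ∀ k, 0 ≤ q k + t * v k := by
    rintro t ⟨ht0, htε⟩ k
    have hsingle : (0 : Fin d → ℝ) ≤ Pi.single i (μ i) := Pi.single_nonneg.2 (hμ i).le
    have hi : 0 ≤ t * (Pi.single i (μ i) : Fin d → ℝ) k :=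
      mul_nonneg ht0 (hsingle k)
    have hk : t * (Pi.single j (μ j) : Fin d → ℝ) k ≤ q k := by
      rcases eq_or_ne k j with rfl | hkj
      · simpa using (le_div_iff₀ (hμ k)).1 htε
      · simpa [hkj] using hq0 k
    simp only [hv, mul_sub]
    linarith
  have hmem : ∀ t ∈ Set.Icc 0 ε, (fun k => q k + t * v k) ∈ workloadSimplex μ w := by
    refine fun t ht => ⟨hnonneg t ht, ?_⟩
    have h0 : ∑ k, (μ k)⁻¹ * v k = 0 := by
      rw [hsum, inv_mul_cancel₀ (hμ i).ne', inv_mul_cancel₀ (hμ j).ne', sub_self]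
    calc ∑ k, (μ k)⁻¹ * (q k + t * v k)
        = ∑ k, (μ k)⁻¹ * q k + t * ∑ k, (μ k)⁻¹ * v k := by
          rw [Finset.mul_sum, ← Finset.sum_add_distrib]
          exact Finset.sum_congr rfl fun k _ => by ring
      _ = w := by rw [h0, hqw, mul_zero, add_zero]
  have hderiv : HasDerivWithinAt (fun t : ℝ => ∑ k, (cf k).C (q k + t * v k))
      (∑ k, (cf k).C' (q k) * v k) (Set.Icc 0 ε) 0 := by
    refine HasDerivWithinAt.fun_sum fun k _ => ?_
    have hlin : HasDerivWithinAt (fun t : ℝ => q k + t * v k) (v k) (Set.Icc 0 ε) 0 := by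
      simpa using (((hasDerivAt_id (0 : ℝ)).mul_const (v k)).const_add (q k)).hasDerivWithinAt
    exact HasDerivWithinAt.comp_of_eq 0 ((cf k).hasDeriv (q k) (hq0 k)) hlin
      (fun t ht => hnonneg t ht k) (by simp)
  have hloc : IsLocalMinOn (fun t : ℝ => ∑ k, (cf k).C (q k + t * v k)) (Set.Icc 0 ε) 0 := by
    refine IsMinOn.localize fun t ht => ?_
    simpa using hmin (hmem t ht)
  have hcone : ε ∈ posTangentConeAt (Set.Icc 0 ε) 0 := by
    refine mem_posTangentConeAt_of_segment_subset ?_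
    rw [zero_add, segment_eq_Icc hε0.le]
  have h := hloc.hasFDerivWithinAt_nonneg hderiv.hasFDerivWithinAt hcone
  rw [hsum fun k => (cf k).C' (q k)] at h
  simp only [ContinuousLinearMap.toSpanSingleton_apply, smul_eq_mul] at h
  have := nonneg_of_mul_nonneg_right h hε0
  linarith

/-- Allocations that equalize the indices `μ i * C' (q i)` are monotone in the total workload. -/
lemma le_of_equal_indices (hμ : ∀ i, 0 < μ i) (cf : Fin d → CostFun) {w w' : ℝ}
    (hw : w ≤ w') {q q' : Fin d → ℝ} (hq : q ∈ workloadSimplex μ w)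
    (hq' : q' ∈ workloadSimplex μ w')
    (h : ∀ i j, μ i * (cf i).C' (q i) = μ j * (cf j).C' (q j))
    (h' : ∀ i j, μ i * (cf i).C' (q' i) = μ j * (cf j).C' (q' j)) (i : Fin d) :
    q i ≤ q' i := by
  by_contra! hi
  have hall (j : Fin d) : q' j < q j := by
    have hlt := mul_lt_mul_of_pos_left
      ((cf i).strictMonoOn_deriv (hq'.1 i) (hq.1 i) hi) (hμ i)
    rw [h i j, h' i j] at hlt
    exact ((cf j).strictMonoOn_deriv.lt_iff_lt (hq'.1 j) (hq.1 j)).1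
      (lt_of_mul_lt_mul_left hlt (hμ j).le)
  have hsum : ∑ j, (μ j)⁻¹ * q' j < ∑ j, (μ j)⁻¹ * q j :=
    Finset.sum_lt_sum_of_nonempty ⟨i, Finset.mem_univ i⟩ fun j _ =>
      mul_lt_mul_of_pos_left (hall j) (inv_pos.2 (hμ j))
  rw [hq.2, hq'.2] at hsum
  exact hsum.not_ge hw

lemma abs_sub_le_of_equal_indices (hμ : ∀ i, 0 < μ i) (cf : Fin d → CostFun)
    {f : ℝ → Fin d → ℝ} (hf : ∀ w ≥ 0, f w ∈ workloadSimplex μ w)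
    (h : ∀ w ≥ 0, ∀ i j, μ i * (cf i).C' (f w i) = μ j * (cf j).C' (f w j))
    {w w' : ℝ} (hw : 0 ≤ w) (hw' : 0 ≤ w') (i : Fin d) :
    |f w i - f w' i| ≤ μ i * |w - w'| := by
  wlog hle : w' ≤ w generalizing w w'
  · rw [abs_sub_comm, abs_sub_comm w]
    exact this hw' hw (le_of_not_ge hle)
  have hmono (j : Fin d) : f w' j ≤ f w j :=
    le_of_equal_indices hμ cf hle (hf w' hw') (hf w hw) (h w' hw') (h w hw) j
  have hi : (μ i)⁻¹ * (f w i - f w' i) ≤ ∑ j, (μ j)⁻¹ * (f w j - f w' j) :=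
    Finset.single_le_sum (f := fun j => (μ j)⁻¹ * (f w j - f w' j))
      (fun j _ => mul_nonneg (inv_nonneg.2 (hμ j).le) (sub_nonneg.2 (hmono j)))
      (Finset.mem_univ i)
  simp only [mul_sub, Finset.sum_sub_distrib, (hf w hw).2, (hf w' hw').2] at hi
  rw [← mul_sub, inv_mul_le_iff₀ (hμ i)] at hi
  rwa [abs_of_nonneg (sub_nonneg.2 (hmono i)), abs_of_nonneg (sub_nonneg.2 hle)]

end

/-- Lemma 3.1: existence of a continuous minimizing curve `f` with
`θ·f(w) = w`, `C(f(w)) = inf{C(q) : q ≥ 0, θ·q = w}` and all the indices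
`μ_i C_i'(f_i(w))` equal. Here `θ_i = μ_i⁻¹`. -/
theorem exists_continuous_minimizing_curve
    (d : ℕ) (hd : 0 < d) (u₁ : ℝ) (hu₁ : 0 < u₁)
    (cf : Fin d → CostFun)
    (hgrowth : ∀ i, ∀ x ≥ (0:ℝ), (cf i).C x ≤ u₁ * x)
    (μ : Fin d → ℝ) (hμ : ∀ i, 0 < μ i) :
    ∃ f : ℝ → Fin d → ℝ,
      ContinuousOn f (Set.Ici 0) ∧
      ∀ w ≥ (0:ℝ),
        (∀ i, 0 ≤ f w i) ∧
        (∑ i, (μ i)⁻¹ * f w i = w) ∧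
        (∑ i, (cf i).C (f w i)
            = sInf {s : ℝ | ∃ q : Fin d → ℝ, (∀ i, 0 ≤ q i) ∧
                (∑ i, (μ i)⁻¹ * q i = w) ∧ s = ∑ i, (cf i).C (q i)}) ∧
        (∀ i j, μ i * (cf i).C' (f w i) = μ j * (cf j).C' (f w j)) := by
  have hex (w : ℝ) : ∃ q : Fin d → ℝ, 0 ≤ w → q ∈ workloadSimplex μ w ∧
      IsMinOn (fun q => ∑ i, (cf i).C (q i)) (workloadSimplex μ w) q := by
    by_cases hw : 0 ≤ w
    · obtain ⟨q, hq, hmin⟩ := (isCompact_workloadSimplex hμ w).exists_isMinOn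
        (workloadSimplex_nonempty hd hμ hw) (f := fun q => ∑ i, (cf i).C (q i))
        (continuousOn_finsetSum _ fun i _ => (cf i).continuousOn.comp
          (continuous_apply i).continuousOn fun q hq => hq.1 i)
      exact ⟨q, fun _ => ⟨hq, hmin⟩⟩
    · exact ⟨0, fun h => absurd h hw⟩
  choose f hf using hex
  have hmem : ∀ w ≥ 0, f w ∈ workloadSimplex μ w := fun w hw => (hf w hw).1
  have hidx : ∀ w ≥ 0, ∀ i j, μ i * (cf i).C' (f w i) = μ j * (cf j).C' (f w j) :=
    fun w hw i j => le_antisymm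
      (mul_deriv_le_of_isMinOn hμ cf (hmem w hw) (hf w hw).2 j i)
      (mul_deriv_le_of_isMinOn hμ cf (hmem w hw) (hf w hw).2 i j)
  refine ⟨f, continuousOn_pi.2 fun i => ?_, fun w hw =>
    ⟨(hmem w hw).1, (hmem w hw).2, ?_, hidx w hw⟩⟩
  · refine LipschitzOnWith.continuousOn (K := ⟨μ i, (hμ i).le⟩) <|
      LipschitzOnWith.of_dist_le_mul fun w hw w' hw' => ?_
    exact abs_sub_le_of_equal_indices hμ cf hmem hidx hw hw' i
  · symm
    refine IsLeast.csInf_eq ⟨⟨f w, (hmem w hw).1, (hmem w hw).2, rfl⟩, ?_⟩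
    rintro s ⟨q, hq, hqw, rfl⟩
    exact (hf w hw).2 ⟨hq, hqw⟩
end

section
/- Let f : [0,∞) → [0,∞)^d be the function assigning to each w ≥ 0 the unique point q^w with θ·q^w = w and all µ_i C_i′(q^w_i) equal. Then f(0) = 0 and, for every w > 0 and every i ∈ {1,…,d}, f_i(w) > 0. -/
/-- The derivative of a cost function is positive away from the origin. -/
theorem CostFun.deriv_pos (c : CostFun) {x : ℝ} (hx : 0 < x) : 0 < c.C' x := by
  have hslope : slope c.C 0 x ≤ c.C' x :=
    c.strictConvex.convexOn.slope_le_of_hasDerivWithinAt Set.self_mem_Ici hx.le hx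
      (c.hasDeriv x hx.le)
  have hC : 0 < c.C x := c.zero ▸ c.strictMono Set.self_mem_Ici hx.le hx
  refine lt_of_lt_of_le ?_ hslope
  rw [slope_def_field, c.zero, sub_zero, sub_zero]
  exact div_pos hC hx

/-- Let `f : [0,∞) → [0,∞)^d` assign to each `w ≥ 0` the unique point `q^w`
with `θ·q^w = w` (with `θ_i = μ_i⁻¹`) and all `μ_i C_i'(q^w_i)` equal.
Then `f(0) = 0`, and `f_i(w) > 0` for every `w > 0` and every `i`. -/
theorem f_zero_and_positive
    (d : ℕ) (hd : 0 < d) (u₁ : ℝ) (hu₁ : 0 < u₁)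
    (cf : Fin d → CostFun)
    (hgrowth : ∀ i, ∀ x ≥ (0:ℝ), (cf i).C x ≤ u₁ * x)
    (μ : Fin d → ℝ) (hμ : ∀ i, 0 < μ i)
    (f : ℝ → Fin d → ℝ)
    (hf : ∀ w ≥ (0:ℝ),
      (∀ i, 0 ≤ f w i) ∧ (∑ i, (μ i)⁻¹ * f w i = w) ∧
      (∀ i j, μ i * (cf i).C' (f w i) = μ j * (cf j).C' (f w j))) :
    (∀ i, f 0 i = 0) ∧ (∀ w > (0:ℝ), ∀ i, 0 < f w i) := by
  refine ⟨fun i => ?_, fun w hw i => ?_⟩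
  · obtain ⟨hnonneg, hsum, -⟩ := hf 0 le_rfl
    have hi := (Finset.sum_eq_zero_iff_of_nonneg
      fun j _ => mul_nonneg (inv_nonneg.2 (hμ j).le) (hnonneg j)).1 hsum i (Finset.mem_univ i)
    exact (mul_eq_zero.1 hi).resolve_left (inv_ne_zero (hμ i).ne')
  · obtain ⟨hnonneg, hsum, heq⟩ := hf w hw.le
    refine (hnonneg i).lt_of_ne' fun hi => hw.ne ?_
    rw [← hsum]
    refine (Finset.sum_eq_zero fun j _ => ?_).symm
    suffices f w j = 0 by rw [this, mul_zero]
    by_contra hj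
    have hpos := mul_pos (hμ j) ((cf j).deriv_pos ((hnonneg j).lt_of_ne' hj))
    rw [heq j i, hi, (cf i).deriv_zero, mul_zero] at hpos
    exact hpos.false
end

section
/- The one-dimensional Skorohod map is Lipschitz with constant 2 in the sup norm: for all bounded functions z, z′ : [0,T] → ℝ and every t ∈ [0,T], sup_{s ∈ [0,t]} |Γ[z](s) − Γ[z′](s)| ≤ 2 sup_{s ∈ [0,t]} |z(s) − z′(s)|. -/
/-- The one-dimensional Skorohod map:
`Γ[z](t) = z(t) − inf_{s ∈ [0,t]} (z(s) ∧ 0)`. -/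
noncomputable def SkMap (z : ℝ → ℝ) (t : ℝ) : ℝ :=
  z t - sInf ((fun s => min (z s) 0) '' Set.Icc 0 t)

theorem sInf_image_le_sInf_image_add {α : Type*} {S : Set α} (hS : S.Nonempty)
    {f g : α → ℝ} {c : ℝ} (hf : BddBelow (f '' S)) (h : ∀ x ∈ S, f x ≤ g x + c) :
    sInf (f '' S) ≤ sInf (g '' S) + c := by
  rw [← sub_le_iff_le_add]
  refine le_csInf (hS.image g) ?_
  rintro _ ⟨x, hx, rfl⟩
  linarith [csInf_le hf (Set.mem_image_of_mem f hx), h x hx]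

theorem abs_sInf_image_sub_sInf_image_le {α : Type*} {S : Set α} (hS : S.Nonempty)
    {f g : α → ℝ} {c : ℝ} (hf : BddBelow (f '' S)) (hg : BddBelow (g '' S))
    (h : ∀ x ∈ S, |f x - g x| ≤ c) :
    |sInf (f '' S) - sInf (g '' S)| ≤ c := by
  rw [abs_sub_le_iff, sub_le_iff_le_add', sub_le_iff_le_add']
  exact ⟨sInf_image_le_sInf_image_add hS hf fun x hx => by
      linarith [(abs_sub_le_iff.1 (h x hx)).1],
    sInf_image_le_sInf_image_add hS hg fun x hx => by
      linarith [(abs_sub_le_iff.1 (h x hx)).2]⟩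

theorem bddBelow_image_min_zero {α : Type*} {S : Set α} {f : α → ℝ} {M : ℝ}
    (hf : ∀ x ∈ S, |f x| ≤ M) : BddBelow ((fun x => min (f x) 0) '' S) := by
  refine ⟨-M, ?_⟩
  rintro _ ⟨x, hx, rfl⟩
  have := hf x hx
  exact le_min (neg_le_of_abs_le this) (by linarith [abs_nonneg (f x)])

/-- The one-dimensional Skorohod map is Lipschitz with constant `2` in the sup
norm: for bounded `z, z' : [0,T] → ℝ` and `t ∈ [0,T]`,
`sup_{s ∈ [0,t]} |Γ[z](s) − Γ[z'](s)| ≤ 2 sup_{s ∈ [0,t]} |z(s) − z'(s)|`. -/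
theorem skorokhod_map_lipschitz
    (T : ℝ) (hT : 0 < T) (z z' : ℝ → ℝ)
    (Mz : ℝ) (hz : ∀ s ∈ Set.Icc (0:ℝ) T, |z s| ≤ Mz)
    (Mz' : ℝ) (hz' : ∀ s ∈ Set.Icc (0:ℝ) T, |z' s| ≤ Mz') :
    ∀ t ∈ Set.Icc (0:ℝ) T, ∀ s ∈ Set.Icc (0:ℝ) t,
      |SkMap z s - SkMap z' s|
        ≤ 2 * sSup ((fun u => |z u - z' u|) '' Set.Icc 0 t) := by
  intro t ht s hs
  set c := sSup ((fun u => |z u - z' u|) '' Set.Icc 0 t)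
  have hst : Set.Icc 0 s ⊆ Set.Icc 0 t := Set.Icc_subset_Icc_right hs.2
  have htT : Set.Icc 0 t ⊆ Set.Icc 0 T := Set.Icc_subset_Icc_right ht.2
  have hbdd : BddAbove ((fun u => |z u - z' u|) '' Set.Icc 0 t) := by
    refine ⟨Mz + Mz', ?_⟩
    rintro _ ⟨u, hu, rfl⟩
    exact (abs_sub _ _).trans (add_le_add (hz u (htT hu)) (hz' u (htT hu)))
  have hc : ∀ u ∈ Set.Icc 0 t, |z u - z' u| ≤ c := fun u hu =>
    le_csSup hbdd (Set.mem_image_of_mem _ hu)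
  have hinf := abs_sInf_image_sub_sInf_image_le (Set.nonempty_Icc.2 hs.1)
    (bddBelow_image_min_zero fun u hu => hz u (htT (hst hu)))
    (bddBelow_image_min_zero fun u hu => hz' u (htT (hst hu)))
    (fun u hu => (abs_min_sub_min_le_max (z u) 0 (z' u) 0).trans
      (max_le (hc u (hst hu)) (by simpa using (abs_nonneg _).trans (hc u (hst hu)))))
  have hs' := hc s hs
  unfold SkMap
  rw [abs_le] at hinf hs' ⊢
  constructor <;> linarith [hinf.1, hinf.2, hs'.1, hs'.2]
end

section
/- Admissibility of the game strategy: let θ₁,…,θ_d > 0 and let f : [0,∞) → [0,∞)^d be continuous with θ·f(w) = w for all w ≥ 0. For a continuous ξ : [0,T] → ℝ^d with ξ(0) = 0, define w = Γ[θ·ξ], φ(t) = f(w(t)) and ζ = φ − ξ. Then: (i) φ_i(t) ≥ 0 for all i and t; (ii) θ·ζ(0) = 0 and t ↦ θ·ζ(t) is nondecreasing; and (iii) the map ξ ↦ ζ is causal, i.e., if ξ and ξ′ are continuous, vanish at 0, and agree on [0,t], then the corresponding ζ and ζ′ agree on [0,t]. -/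
/-- Given `θ` and `f`, the strategy of the game assigns to an input path `ξ`
the path `ζ = φ − ξ`, where `φ(t) = f(Γ[θ·ξ](t))`. -/
noncomputable def gameZeta {d : ℕ} (θ : Fin d → ℝ) (f : ℝ → Fin d → ℝ)
    (ξ : ℝ → Fin d → ℝ) (t : ℝ) : Fin d → ℝ :=
  fun i => f (SkMap (fun s => ∑ j, θ j * ξ s j) t) i - ξ t i

theorem SkMap_congr {z z' : ℝ → ℝ} {t : ℝ} (ht : 0 ≤ t)
    (h : Set.EqOn z z' (Set.Icc 0 t)) : SkMap z t = SkMap z' t := by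
  have himage : (fun s => min (z s) 0) '' Set.Icc 0 t =
      (fun s => min (z' s) 0) '' Set.Icc 0 t :=
    Set.image_congr fun s hs => by rw [h hs]
  rw [SkMap, SkMap, h ⟨ht, le_rfl⟩, himage]

theorem bddBelow_image_min_zero_s19 {z : ℝ → ℝ} {T t : ℝ} (hz : ContinuousOn z (Set.Icc 0 T))
    (ht : t ≤ T) : BddBelow ((fun s => min (z s) 0) '' Set.Icc 0 t) :=
  isCompact_Icc.bddBelow_image
    ((hz.mono (Set.Icc_subset_Icc_right ht)).inf continuousOn_const)

theorem SkMap_nonneg {z : ℝ → ℝ} {T t : ℝ} (hz : ContinuousOn z (Set.Icc 0 T))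
    (ht : t ∈ Set.Icc 0 T) : 0 ≤ SkMap z t :=
  sub_nonneg.2 <| (csInf_le (bddBelow_image_min_zero_s19 hz ht.2)
    (Set.mem_image_of_mem _ ⟨ht.1, le_rfl⟩)).trans (min_le_left _ _)

theorem SkMap_zero {z : ℝ → ℝ} (hz : z 0 = 0) : SkMap z 0 = 0 := by
  simp [SkMap, hz]

theorem monotoneOn_SkMap_sub {z : ℝ → ℝ} {T : ℝ} (hz : ContinuousOn z (Set.Icc 0 T)) :
    MonotoneOn (fun t => SkMap z t - z t) (Set.Icc 0 T) := by
  intro a ha b hb hab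
  have h : sInf ((fun s => min (z s) 0) '' Set.Icc 0 b) ≤
      sInf ((fun s => min (z s) 0) '' Set.Icc 0 a) :=
    csInf_le_csInf (bddBelow_image_min_zero_s19 hz hb.2)
      ((Set.nonempty_Icc.2 ha.1).image _)
      (Set.image_mono (Set.Icc_subset_Icc_right hab))
  simp only [SkMap]
  linarith

/-- Admissibility of the game strategy: with `w = Γ[θ·ξ]`, `φ = f ∘ w` and
`ζ = φ − ξ`, one has (i) `φ_i(t) ≥ 0`; (ii) `θ·ζ(0) = 0` and `t ↦ θ·ζ(t)` is
nondecreasing; (iii) the map `ξ ↦ ζ` is causal. -/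
theorem game_strategy_admissible
    (T : ℝ) (hT : 0 < T) (d : ℕ) (hd : 0 < d)
    (θ : Fin d → ℝ) (hθ : ∀ i, 0 < θ i)
    (f : ℝ → Fin d → ℝ)
    (hfc : ContinuousOn f (Set.Ici 0))
    (hfnn : ∀ w ≥ (0:ℝ), ∀ i, 0 ≤ f w i)
    (hfθ : ∀ w ≥ (0:ℝ), ∑ i, θ i * f w i = w) :
    (∀ ξ : ℝ → Fin d → ℝ, ContinuousOn ξ (Set.Icc 0 T) → ξ 0 = 0 →
      (∀ t ∈ Set.Icc (0:ℝ) T, ∀ i,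
        0 ≤ f (SkMap (fun s => ∑ j, θ j * ξ s j) t) i) ∧
      (∑ i, θ i * gameZeta θ f ξ 0 i = 0) ∧
      MonotoneOn (fun t => ∑ i, θ i * gameZeta θ f ξ t i) (Set.Icc 0 T)) ∧
    (∀ ξ ξ' : ℝ → Fin d → ℝ,
      ContinuousOn ξ (Set.Icc 0 T) → ContinuousOn ξ' (Set.Icc 0 T) →
      ξ 0 = 0 → ξ' 0 = 0 →
      ∀ t ∈ Set.Icc (0:ℝ) T, (∀ s ∈ Set.Icc (0:ℝ) t, ξ s = ξ' s) →
        ∀ s ∈ Set.Icc (0:ℝ) t, gameZeta θ f ξ s = gameZeta θ f ξ' s) := by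
  refine ⟨fun ξ hξ hξ0 => ?_, fun ξ ξ' _ _ _ _ t _ h s hs => ?_⟩
  · have hz : ContinuousOn (fun s => ∑ j, θ j * ξ s j) (Set.Icc 0 T) :=
      continuousOn_finsetSum _ fun j _ =>
        continuousOn_const.mul (continuousOn_pi.1 hξ j)
    have hζ : ∀ t ∈ Set.Icc (0:ℝ) T, ∑ i, θ i * gameZeta θ f ξ t i =
        SkMap (fun s => ∑ j, θ j * ξ s j) t - ∑ j, θ j * ξ t j := by
      intro t ht
      simp only [gameZeta, mul_sub, Finset.sum_sub_distrib]
      rw [hfθ _ (SkMap_nonneg hz ht)]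
    refine ⟨fun t ht i => hfnn _ (SkMap_nonneg hz ht) i, ?_, ?_⟩
    · rw [hζ 0 ⟨le_rfl, hT.le⟩, SkMap_zero (by simp [hξ0])]
      simp [hξ0]
    · exact (monotoneOn_SkMap_sub hz).congr fun t ht => (hζ t ht).symm
  · have hSk : SkMap (fun s => ∑ j, θ j * ξ s j) s =
        SkMap (fun s => ∑ j, θ j * ξ' s j) s :=
      SkMap_congr hs.1 fun r hr => by
        simp only [h r ⟨hr.1, hr.2.trans hs.2⟩]
    funext i
    simp only [gameZeta]
    rw [hSk, h s hs]
end
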